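/- Let G be a group with generating set S, and let v and w be two distinct equivalent paths (words in S). Then there exist paths v₀, v₁, w₀, w₁ and x such that v = v₀v₁x and w = w₀w₁x (as concatenations of words), v₀ is equivalent to w₀, v₁ is equivalent to w₁ (in particular v₁ and w₁ have the same length), and the word v₁w̄₁ is a primitive relator of even length. -/

import Mathlib

variable {G : Type*} [Group G]

/-- A word in `S`: a finite list of letters `s^{±1}` with `s ∈ S`. -/
def IsWord (S : Set G) (w : List G) : Prop := ∀ x ∈ w, x ∈ S ∨ x⁻¹ ∈ S

/-- A relator: a nonempty word representing the identity. -/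
def IsRelator (S : Set G) (w : List G) : Prop := IsWord S w ∧ w ≠ [] ∧ w.prod = 1

/-- A word is reduced in `G` if none of its nonempty subwords is a relator. -/
def ReducedIn (S : Set G) (w : List G) : Prop :=
  IsWord S w ∧ ∀ v' v v'' : List G, w = v' ++ v ++ v'' → v ≠ [] → v.prod ≠ 1

/-- A primitive relator: a relator all of whose proper subwords are reduced in `G`,
i.e. a relator with no proper subrelator. -/
def IsPrimitiveRelator (S : Set G) (w : List G) : Prop :=
  IsRelator S w ∧ ∀ v' v v'' : List G, w = v' ++ v ++ v'' → v ≠ w → v ≠ [] → v.prod ≠ 1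

/-- The word norm `|g|`: the least length of a word in `S` representing `g`. -/
noncomputable def wordNorm (S : Set G) (g : G) : ℕ :=
  sInf {n | ∃ w : List G, IsWord S w ∧ w.prod = g ∧ w.length = n}

/-- A path: a word whose length equals the word norm of the element it represents. -/
def IsPath (S : Set G) (w : List G) : Prop :=
  IsWord S w ∧ w.length = wordNorm S w.prod

/-- The formal inverse `w̄` of a word `w = t₁…tₙ`, namely `tₙ⁻¹…t₁⁻¹`. -/
def wordInv (w : List G) : List G := (w.map fun x => x⁻¹).reverse

theorem IsWord.append {S : Set G} {a b : List G} (ha : IsWord S a) (hb : IsWord S b) :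
    IsWord S (a ++ b) := fun x hx => (List.mem_append.1 hx).elim (ha x) (hb x)

theorem IsWord.wordInv {S : Set G} {a : List G} (ha : IsWord S a) : IsWord S (wordInv a) := by
  intro x hx
  simp only [_root_.wordInv, List.mem_reverse, List.mem_map] at hx
  obtain ⟨y, hy, rfl⟩ := hx
  simpa [or_comm] using ha y hy

theorem prod_wordInv (a : List G) : (wordInv a).prod = a.prod⁻¹ := (List.prod_inv_reverse a).symm

theorem length_wordInv (a : List G) : (wordInv a).length = a.length := by simp [wordInv]

theorem wordInv_append (a b : List G) : wordInv (a ++ b) = wordInv b ++ wordInv a := by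
  simp [wordInv]

theorem wordInv_wordInv (a : List G) : wordInv (wordInv a) = a := by
  simp [wordInv]

theorem wordNorm_le_length {S : Set G} {a : List G} (ha : IsWord S a) :
    wordNorm S a.prod ≤ a.length := Nat.sInf_le ⟨a, ha, rfl, rfl⟩

/-- Every word is equivalent to a word realizing the word norm. -/
theorem IsWord.exists_length_eq_wordNorm {S : Set G} {a : List G} (ha : IsWord S a) :
    ∃ b, IsWord S b ∧ b.prod = a.prod ∧ b.length = wordNorm S a.prod :=
  Nat.sInf_mem (s := {n | ∃ w : List G, IsWord S w ∧ w.prod = a.prod ∧ w.length = n})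
    ⟨_, a, ha, rfl, rfl⟩

/-- A subword of a path is a path. -/
theorem IsPath.of_subword {S : Set G} {a b c : List G} (h : IsPath S (a ++ b ++ c)) :
    IsPath S b := by
  obtain ⟨hword, hlen⟩ := h
  have ha : IsWord S a := fun x hx => hword x (by simp [hx])
  have hb : IsWord S b := fun x hx => hword x (by simp [hx])
  have hc : IsWord S c := fun x hx => hword x (by simp [hx])
  obtain ⟨b', hb', hprod, hlen'⟩ := hb.exists_length_eq_wordNorm
  have key := wordNorm_le_length ((ha.append hb').append hc)
  have hEq : (a ++ b' ++ c).prod = (a ++ b ++ c).prod := by simp [hprod]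
  rw [hEq, ← hlen] at key
  simp only [List.length_append] at key
  exact ⟨hb, le_antisymm (by omega) (wordNorm_le_length hb)⟩

theorem IsPath.of_append_left {S : Set G} {a b : List G} (h : IsPath S (a ++ b)) : IsPath S a :=
  IsPath.of_subword (a := []) (c := b) (by simpa using h)

theorem IsPath.of_append_right {S : Set G} {a b : List G} (h : IsPath S (a ++ b)) : IsPath S b :=
  IsPath.of_subword (a := a) (c := []) (by simpa using h)

theorem IsPath.length_eq {S : Set G} {a b : List G} (ha : IsPath S a) (hb : IsPath S b)
    (h : a.prod = b.prod) : a.length = b.length := by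
  rw [ha.2, hb.2, h]

theorem IsPath.nil (S : Set G) : IsPath S ([] : List G) := by
  have hword : IsWord S ([] : List G) := fun x hx => by simp at hx
  exact ⟨hword, le_antisymm (Nat.zero_le _) (wordNorm_le_length hword)⟩

theorem IsPath.eq_nil {S : Set G} {a : List G} (ha : IsPath S a) (h : a.prod = 1) : a = [] :=
  List.eq_nil_of_length_eq_zero (ha.length_eq (IsPath.nil S) (by simpa using h))

/-- If `v` and `w` are distinct equivalent paths, then `v = v₀v₁x`, `w = w₀w₁x` with
`v₀ ~ w₀`, `v₁ ~ w₁` (so `v₁`, `w₁` have the same length), all pieces being paths,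
and `v₁w̄₁` is a primitive relator of even length. -/
theorem equivalent_paths_decomposition (S : Set G) (hgen : Subgroup.closure S = ⊤)
    (v w : List G) (hv : IsPath S v) (hw : IsPath S w)
    (hne : v ≠ w) (heq : v.prod = w.prod) :
    ∃ v₀ v₁ w₀ w₁ x : List G,
      IsPath S v₀ ∧ IsPath S v₁ ∧ IsPath S w₀ ∧ IsPath S w₁ ∧ IsPath S x ∧
      v = v₀ ++ v₁ ++ x ∧ w = w₀ ++ w₁ ++ x ∧
      v₀.prod = w₀.prod ∧ v₁.prod = w₁.prod ∧ v₁.length = w₁.length ∧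
      IsPrimitiveRelator S (v₁ ++ wordInv w₁) ∧ Even (v₁ ++ wordInv w₁).length := by
  classical
  have hvne : v ≠ [] := by
    rintro rfl
    exact hne (hw.eq_nil (by simpa using heq.symm)).symm
  -- the shortest nonempty equivalent suffixes of `v` and `w`
  have hex : ∃ k, ∃ v₀ v₁ w₀ w₁ : List G, v = v₀ ++ v₁ ∧ w = w₀ ++ w₁ ∧ v₁ ≠ [] ∧
      v₁.prod = w₁.prod ∧ v₁.length = k := ⟨_, [], v, [], w, rfl, rfl, hvne, heq, rfl⟩
  have hmin := fun m => Nat.find_min' hex (m := m)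
  obtain ⟨v₀, v₁, w₀, w₁, rfl, rfl, hv₁ne, hprod, hk⟩ := Nat.find_spec hex
  rw [← hk] at hmin
  have hv₁ := hv.of_append_right
  have hw₁ := hw.of_append_right
  have hlen := hv₁.length_eq hw₁ hprod
  refine ⟨v₀, v₁, w₀, w₁, [], hv.of_append_left, hv₁, hw.of_append_left, hw₁, IsPath.nil S,
    by simp, by simp, ?_, hprod, hlen,
    ⟨⟨hv₁.1.append hw₁.1.wordInv, by simp [hv₁ne], by simp [prod_wordInv, hprod]⟩, ?_⟩,
    ⟨v₁.length, by simp [length_wordInv, hlen]⟩⟩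
  · simpa [hprod] using heq
  intro v' u v'' hu huproper hune hu1
  rw [List.append_assoc, List.append_eq_append_iff] at hu
  obtain ⟨c, -, hc⟩ | ⟨c, hc, hcW⟩ := hu
  · -- `u` is a subword of the inverse of `w₁`
    have hw' : w₁ = wordInv v'' ++ wordInv u ++ wordInv c := by
      rw [← wordInv_wordInv w₁, hc, wordInv_append, wordInv_append]
    have := (hw' ▸ hw₁).of_subword.eq_nil (by simp [prod_wordInv, hu1])
    exact hune (by rw [← wordInv_wordInv u, this]; rfl)
  · obtain ⟨d, hd, -⟩ | ⟨d, hd, hd'⟩ := List.append_eq_append_iff.1 hcW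
    · -- `u` is a subword of `v₁`
      subst hd
      rw [← List.append_assoc] at hc
      exact hune ((hc ▸ hv₁).of_subword.eq_nil hu1)
    · -- `u` is a suffix of `v₁` followed by the inverse of a suffix of `w₁`
      have hw' : w₁ = wordInv v'' ++ wordInv d := by
        rw [← wordInv_wordInv w₁, hd', wordInv_append]
      have hcp : c.prod = (wordInv d).prod := by
        rw [prod_wordInv, eq_inv_iff_mul_eq_one, ← List.prod_append, ← hd, hu1]
      have hcpath : IsPath S c := (hc ▸ hv₁).of_append_right
      have hdlen := hcpath.length_eq (hw' ▸ hw₁).of_append_right hcp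
      rw [length_wordInv] at hdlen
      have hcne : c ≠ [] := by
        rintro rfl
        have hd0 : d = [] := List.eq_nil_of_length_eq_zero (by simpa using hdlen.symm)
        exact hune (by simp [hd, hd0])
      have hle := hmin c.length ⟨v₀ ++ v', c, w₀ ++ wordInv v'', wordInv d,
        by simp [hc], by simp [hw'], hcne, hcp, rfl⟩
      have h1 := congrArg List.length hc
      have h2 := congrArg List.length hw'
      simp only [List.length_append, length_wordInv] at h1 h2
      have h3 : v' = [] := List.eq_nil_of_length_eq_zero (by omega)
      have h4 : v'' = [] := List.eq_nil_of_length_eq_zero (by omega)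
      exact huproper (by simp [hd, hc, hd', h3, h4])
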